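/- Let F be a field, k >= 1, j >= 1 integers, and let A = {a_1,...,a_N} be a finite family of N vectors in F^k such that every a_i lies in the span of at most j of the other vectors of the family (i.e., for each i there is a set R_i of at most j indices, not containing i, with a_i in span{a_l : l in R_i}). Then the dimension of the span of {a_1,...,a_N} is at most N - ceil(N / (j+1)). -/

import Mathlib

/-- If every coordinate is in the support of some vector of `K` with at most `m` nonzero
coordinates, then the number of coordinates is at most `dim K * m`. -/
theorem card_le_finrank_mul_of_forall_exists_support_card_le {F ι : Type*} [Field F]
    [Fintype ι] [DecidableEq F] (K : Submodule F (ι → F)) (m : ℕ)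
    (h : ∀ i, ∃ w ∈ K, w i ≠ 0 ∧ (Finset.univ.filter fun l => w l ≠ 0).card ≤ m) :
    Fintype.card ι ≤ Module.finrank F K * m := by
  classical
  choose w hwK hwi hwm using h
  obtain ⟨b, hb, hspan, hli⟩ := exists_linearIndependent F (Set.range w)
  have : Fintype b := ((Set.finite_range w).subset hb).fintype
  have hcard : b.toFinset.card ≤ Module.finrank F K := by
    rw [← finrank_span_set_eq_card hli, hspan]
    refine Submodule.finrank_mono (Submodule.span_le.2 ?_)
    rintro _ ⟨i, rfl⟩
    exact hwK i
  have hcover : (Finset.univ : Finset ι) ⊆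
      b.toFinset.biUnion fun v => Finset.univ.filter fun l => v l ≠ 0 := by
    intro i _
    by_contra hi
    simp only [Finset.mem_biUnion, Set.mem_toFinset, Finset.mem_filter, Finset.mem_univ,
      true_and, not_exists, not_and, not_not] at hi
    have hle : Submodule.span F b ≤ LinearMap.ker (LinearMap.proj (R := F) (φ := fun _ => F) i) :=
      Submodule.span_le.2 fun v hv => hi v hv
    rw [hspan] at hle
    exact hwi i (hle (Submodule.subset_span ⟨i, rfl⟩))
  calc Fintype.card ι
      ≤ (b.toFinset.biUnion fun v => Finset.univ.filter fun l => v l ≠ 0).card :=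
        Finset.card_le_card hcover
    _ ≤ b.toFinset.card * m := by
        refine Finset.card_biUnion_le_card_mul _ _ _ fun v hv => ?_
        obtain ⟨i, rfl⟩ := hb (Set.mem_toFinset.1 hv)
        exact hwm i
    _ ≤ Module.finrank F K * m := Nat.mul_le_mul_right m hcard

/-- A vector in the span of a subfamily indexed by `R` yields a linear relation supported on
`insert i R` in which it appears with a nonzero coefficient. -/
theorem exists_mem_ker_linearCombination_of_mem_span {F ι M : Type*} [Field F] [Fintype ι]
    [DecidableEq F] [AddCommGroup M] [Module F M] (a : ι → M) {i : ι} {R : Finset ι}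
    (hi : i ∉ R) (h : a i ∈ Submodule.span F (a '' ↑R)) :
    ∃ w ∈ LinearMap.ker (Fintype.linearCombination F a),
      w i ≠ 0 ∧ (Finset.univ.filter fun l => w l ≠ 0).card ≤ R.card + 1 := by
  classical
  obtain ⟨c, hc⟩ := Submodule.mem_span_image_finset_iff_exists_fun F |>.1 h
  refine ⟨Pi.single i 1 - fun l => if hl : l ∈ R then c ⟨l, hl⟩ else 0, ?_, by simp [hi], ?_⟩
  · rw [LinearMap.mem_ker, map_sub, Fintype.linearCombination_apply_single,
      Fintype.linearCombination_apply]
    rw [one_smul, ← hc, sub_eq_zero]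
    refine (Finset.sum_subset (Finset.subset_univ R) fun l _ hl => by simp [hl]).symm.trans ?_ |>.symm
    rw [← Finset.sum_coe_sort R]
    simp
  · refine (Finset.card_le_card fun l hl => ?_).trans (Finset.card_insert_le i R)
    by_contra hlR
    rw [Finset.mem_insert, not_or] at hlR
    simp [hlR.1, hlR.2] at hl

/-- Counting lemma: if every vector in a family `a_1, …, a_N ∈ F^k` lies in the span of
at most `j` of the other vectors of the family, then the rank of the family is at most
`N - ⌈N/(j+1)⌉` (here `⌈N/(j+1)⌉ = (N + j)/(j+1)` in natural-number arithmetic). -/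
theorem rank_le_of_all_locality_le
    {F : Type*} [Field F] {k N j : ℕ} (hk : 1 ≤ k) (hj : 1 ≤ j)
    (a : Fin N → (Fin k → F))
    (hloc : ∀ i : Fin N, ∃ R : Finset (Fin N), i ∉ R ∧ R.card ≤ j ∧
      a i ∈ Submodule.span F (a '' ↑R)) :
    Module.finrank F (Submodule.span F (Set.range a)) + (N + j) / (j + 1) ≤ N := by
  classical
  have hN := card_le_finrank_mul_of_forall_exists_support_card_le
    (LinearMap.ker (Fintype.linearCombination F a)) (j + 1) fun i => by
      obtain ⟨R, hi, hR, hspan⟩ := hloc i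
      obtain ⟨w, hw, hwi, hcard⟩ := exists_mem_ker_linearCombination_of_mem_span a hi hspan
      exact ⟨w, hw, hwi, hcard.trans (by omega)⟩
  have hrank := LinearMap.finrank_range_add_finrank_ker (Fintype.linearCombination F a)
  rw [Fintype.range_linearCombination, Module.finrank_fin_fun] at hrank
  rw [Fintype.card_fin] at hN
  have hceil : (N + j) / (j + 1) ≤
      Module.finrank F (LinearMap.ker (Fintype.linearCombination F a)) := by
    rw [← Nat.lt_succ_iff, Nat.div_lt_iff_lt_mul j.succ_pos, Nat.succ_mul, Nat.succ_eq_add_one]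
    omega
  omega
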